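/- If F is a free group and N ⊴ F a normal subgroup, then H₂(F/N, ℤ) ≅ (N ∩ [F,F]) / [N,F] (Hopf's formula), identifying the Schur multiplier of the quotient with a relative commutator quotient. -/

import Mathlib

noncomputable section

/-- Degree-2 differential of the bar complex of `G` with trivial `ℤ`-coefficients:
`d₂(g,h) = [h] - [g*h] + [g]`. -/
def barD2 (G : Type*) [Group G] : ((G × G) →₀ ℤ) →+ (G →₀ ℤ) :=
  (Finsupp.lift (G →₀ ℤ) ℤ (G × G) fun p =>
    Finsupp.single p.2 1 - Finsupp.single (p.1 * p.2) 1 + Finsupp.single p.1 1).toAddMonoidHom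

/-- Degree-3 differential of the bar complex of `G` with trivial `ℤ`-coefficients:
`d₃(g,h,k) = [h,k] - [g*h,k] + [g,h*k] - [g,h]`. -/
def barD3 (G : Type*) [Group G] : ((G × G × G) →₀ ℤ) →+ ((G × G) →₀ ℤ) :=
  (Finsupp.lift ((G × G) →₀ ℤ) ℤ (G × G × G) fun p =>
    Finsupp.single (p.2.1, p.2.2) 1 - Finsupp.single (p.1 * p.2.1, p.2.2) 1 +
      Finsupp.single (p.1, p.2.1 * p.2.2) 1 - Finsupp.single (p.1, p.2.1) 1).toAddMonoidHom

/-- Second integral group homology `H₂(G,ℤ)` (the Schur multiplier), defined as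
2-cycles modulo 2-boundaries of the bar complex with trivial `ℤ`-coefficients. -/
abbrev H2 (G : Type*) [Group G] :=
  ↥(barD2 G).ker ⧸ ((barD3 G).range.addSubgroupOf (barD2 G).ker)

/-- Two-chains modulo boundaries. -/
abbrev BarB (G : Type*) [Group G] := ((G × G) →₀ ℤ) ⧸ (barD3 G).range

/-- The universal cocycle. -/
def barC {G : Type*} [Group G] (g h : G) : BarB G :=
  QuotientAddGroup.mk (Finsupp.single (g, h) 1)

theorem barD2_single {G : Type*} [Group G] (g h : G) :
    barD2 G (Finsupp.single (g, h) 1) =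
      Finsupp.single h 1 - Finsupp.single (g * h) 1 + Finsupp.single g 1 := by
  simp [barD2]

theorem barD3_single {G : Type*} [Group G] (g h k : G) :
    barD3 G (Finsupp.single (g, h, k) 1) =
      Finsupp.single (h, k) 1 - Finsupp.single (g * h, k) 1 +
      Finsupp.single (g, h * k) 1 - Finsupp.single (g, h) 1 := by
  simp [barD3]

theorem barC_cocycle {G : Type*} [Group G] (g h k : G) :
    barC h k - barC (g * h) k + barC g (h * k) - barC g h = 0 := by
  have : (QuotientAddGroup.mk (barD3 G (Finsupp.single (g, h, k) 1)) : BarB G) = 0 :=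
    (QuotientAddGroup.eq_zero_iff _).2 ⟨_, rfl⟩
  rw [barD3_single] at this
  exact this

theorem barC_one_left {G : Type*} [Group G] (k : G) : barC 1 k = barC 1 (1 : G) := by
  have := barC_cocycle 1 1 k
  simp only [one_mul, sub_self, zero_add] at this
  exact sub_eq_zero.1 this

theorem barC_one_right {G : Type*} [Group G] (k : G) : barC k 1 = barC 1 (1 : G) := by
  have := barC_cocycle k 1 1
  simp only [mul_one, sub_add_cancel] at this
  exact (sub_eq_zero.1 this).symm

theorem barHom_eq {M A : Type*} [AddCommGroup A] (f g : (M →₀ ℤ) →+ A)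
    (h : ∀ m, f (Finsupp.single m 1) = g (Finsupp.single m 1)) : f = g := by
  refine Finsupp.addHom_ext' fun m => ?_
  ext
  exact h m

theorem barD2_comp {G : Type*} [Group G] : (barD2 G).comp (barD3 G) = 0 := by
  apply barHom_eq
  rintro ⟨g, h, k⟩
  simp only [AddMonoidHom.comp_apply, barD3_single, map_add, map_sub, barD2_single,
    AddMonoidHom.zero_apply, mul_assoc]
  abel

/-- `d₂` on the quotient. -/
def barDbar (G : Type*) [Group G] : BarB G →+ (G →₀ ℤ) :=
  QuotientAddGroup.lift _ (barD2 G) (by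
    rintro _ ⟨x, rfl⟩
    exact DFunLike.congr_fun barD2_comp x)

theorem barDbar_C {G : Type*} [Group G] (g h : G) : barDbar G (barC g h) =
    Finsupp.single h 1 - Finsupp.single (g * h) 1 + Finsupp.single g 1 :=
  barD2_single g h

/-- The universal extension. -/
@[ext] structure BarX (G : Type*) [Group G] where
  b : BarB G
  g : G

instance (G : Type*) [Group G] : Mul (BarX G) := ⟨fun x y => ⟨x.b + y.b + barC x.g y.g, x.g * y.g⟩⟩
instance (G : Type*) [Group G] : One (BarX G) := ⟨⟨-barC 1 1, 1⟩⟩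
instance (G : Type*) [Group G] : Inv (BarX G) := ⟨fun x => ⟨-x.b - barC x.g⁻¹ x.g - barC 1 1, x.g⁻¹⟩⟩

theorem BarX.mul_b {G : Type*} [Group G] (x y : BarX G) :
    (x * y).b = x.b + y.b + barC x.g y.g := rfl
theorem BarX.mul_g {G : Type*} [Group G] (x y : BarX G) : (x * y).g = x.g * y.g := rfl
theorem BarX.one_b {G : Type*} [Group G] : (1 : BarX G).b = -barC 1 1 := rfl
theorem BarX.one_g {G : Type*} [Group G] : (1 : BarX G).g = 1 := rfl
theorem BarX.inv_b {G : Type*} [Group G] (x : BarX G) :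
    (x⁻¹).b = -x.b - barC x.g⁻¹ x.g - barC 1 1 := rfl
theorem BarX.inv_g {G : Type*} [Group G] (x : BarX G) : (x⁻¹).g = x.g⁻¹ := rfl

instance (G : Type*) [Group G] : Group (BarX G) := Group.ofLeftAxioms
  (by
    intro x y z
    ext1
    · have := barC_cocycle x.g y.g z.g
      simp only [BarX.mul_b, BarX.mul_g]
      rw [← sub_eq_zero, ← neg_eq_zero, ← this]
      abel
    · simp only [BarX.mul_g, mul_assoc])
  (by
    intro x
    ext1
    · simp only [BarX.mul_b, BarX.one_b, BarX.one_g, barC_one_left]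
      abel
    · simp only [BarX.mul_g, BarX.one_g, one_mul])
  (by
    intro x
    ext1
    · simp only [BarX.mul_b, BarX.one_b, BarX.inv_b, BarX.inv_g]
      abel
    · simp only [BarX.mul_g, BarX.one_g, BarX.inv_g, inv_mul_cancel])

/-- Projection to `G`. -/
def BarX.proj (G : Type*) [Group G] : BarX G →* G where
  toFun x := x.g
  map_one' := rfl
  map_mul' _ _ := rfl

/-- Homomorphism to one-chains. -/
def BarX.toC1 (G : Type*) [Group G] : BarX G →* Multiplicative (G →₀ ℤ) :=
  MonoidHom.mk' (fun x => Multiplicative.ofAdd (barDbar G x.b + Finsupp.single x.g 1)) (by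
    intro x y
    rw [← ofAdd_add]
    congr 1
    simp only [BarX.mul_b, BarX.mul_g, map_add, barDbar_C]
    abel)

section hopf
variable {α : Type*} (N : Subgroup (FreeGroup α)) [N.Normal]

/-- The lift of the quotient map to the universal extension. -/
def hopfTheta : FreeGroup α →* BarX (FreeGroup α ⧸ N) :=
  FreeGroup.lift fun a => ⟨0, (FreeGroup.of a : FreeGroup α ⧸ N)⟩

theorem hopfTheta_g (x : FreeGroup α) : (hopfTheta N x).g = (x : FreeGroup α ⧸ N) := by
  have : (BarX.proj _).comp (hopfTheta N) = QuotientGroup.mk' N := by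
    ext a
    simp [hopfTheta, BarX.proj]
  exact DFunLike.congr_fun this x

theorem hopfTheta_g_mem {x : FreeGroup α} (hx : x ∈ N) : (hopfTheta N x).g = 1 := by
  rw [hopfTheta_g]
  exact (QuotientGroup.eq_one_iff x).2 hx

/-- The map from `N` to `B`. -/
def hopfPsi : N →* Multiplicative (BarB (FreeGroup α ⧸ N)) :=
  MonoidHom.mk' (fun n => Multiplicative.ofAdd ((hopfTheta N n).b + barC 1 1)) (by
    intro n m
    rw [← ofAdd_add]
    congr 1
    simp only [Subgroup.coe_mul, map_mul, BarX.mul_b, hopfTheta_g_mem N n.2, hopfTheta_g_mem N m.2]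
    abel)

theorem hopfPsi_apply (n : N) :
    (hopfPsi N n).toAdd = (hopfTheta N n).b + barC 1 1 := rfl

theorem hopfPsi_eq_one (n : N) : hopfPsi N n = 1 ↔ hopfTheta N n = 1 := by
  have e : hopfPsi N n = 1 ↔ (hopfTheta N n).b + barC 1 1 = 0 := Iff.rfl
  rw [e, BarX.ext_iff]
  simp only [hopfTheta_g_mem N n.2, BarX.one_g, BarX.one_b, and_true]
  exact add_eq_zero_iff_eq_neg

theorem hopfTheta_comm : ⁅N, (⊤ : Subgroup (FreeGroup α))⁆ ≤ (hopfTheta N).ker := by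
  rw [Subgroup.commutator_le]
  intro n hn f _
  rw [MonoidHom.mem_ker, map_commutatorElement, commutatorElement_eq_one_iff_mul_comm]
  ext1
  · simp only [BarX.mul_b, hopfTheta_g_mem N hn, barC_one_left, barC_one_right]
    abel
  · simp only [BarX.mul_g, hopfTheta_g_mem N hn, one_mul, mul_one]

/-- Set theoretic section. -/
def hopfS (g : FreeGroup α ⧸ N) : FreeGroup α := Quotient.out g

theorem hopfS_mk (g : FreeGroup α ⧸ N) : (hopfS N g : FreeGroup α ⧸ N) = g := 
  QuotientGroup.out_eq' g

theorem hopf_mem (g h : FreeGroup α ⧸ N) : hopfS N g * hopfS N h * (hopfS N (g * h))⁻¹ ∈ N := by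
  rw [← QuotientGroup.eq_one_iff]
  simp [hopfS_mk]

/-- Every chain is hit up to a function of its boundary. -/
theorem hopf_chain (z : ((FreeGroup α ⧸ N) × (FreeGroup α ⧸ N)) →₀ ℤ) :
    ∃ n : N, (hopfPsi N n).toAdd = QuotientAddGroup.mk z +
        Finsupp.liftAddHom (fun g => (zmultiplesHom _) (hopfTheta N (hopfS N g)).b) (barD2 _ z) ∧
      Additive.ofMul (Abelianization.of (n : FreeGroup α)) =
        Finsupp.liftAddHom (fun g => (zmultiplesHom _)
          (Additive.ofMul (Abelianization.of (hopfS N g)))) (barD2 _ z) := by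
  induction z using Finsupp.induction_linear with
  | zero => exact ⟨1, by simp⟩
  | add x y hx hy =>
    obtain ⟨n, hn, hn'⟩ := hx
    obtain ⟨m, hm, hm'⟩ := hy
    refine ⟨n * m, ?_, ?_⟩
    · rw [map_mul, toAdd_mul, hn, hm, map_add, map_add, QuotientAddGroup.mk_add]
      abel
    · rw [Subgroup.coe_mul, map_mul, ofMul_mul, hn', hm', map_add, map_add]
  | single p k =>
    obtain ⟨g, h⟩ := p
    have e : (Finsupp.single (g, h) k : _ →₀ ℤ) = k • Finsupp.single (g, h) 1 := by simp
    refine ⟨⟨_, hopf_mem N g h⟩ ^ k, ?_, ?_⟩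
    · rw [map_zpow, toAdd_zpow, e, map_zsmul, map_zsmul, QuotientAddGroup.mk_zsmul]
      refine Eq.trans ?_ (zsmul_add _ _ k)
      congr 1
      have key : hopfTheta N (hopfS N g * hopfS N h * (hopfS N (g * h))⁻¹) *
          hopfTheta N (hopfS N (g * h)) = hopfTheta N (hopfS N g) * hopfTheta N (hopfS N h) := by
        rw [← map_mul, ← map_mul, inv_mul_cancel_right]
      have kb := congrArg BarX.b key
      simp only [BarX.mul_b, hopfTheta_g_mem N (hopf_mem N g h), hopfTheta_g N (hopfS N _),
        hopfS_mk, barC_one_left] at kb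
      rw [hopfPsi_apply, barD2_single]
      simp only [map_add, map_sub, Finsupp.liftAddHom_apply_single, zmultiplesHom_apply, one_smul]
      change _ = barC g h + _
      rw [← sub_eq_zero] at kb ⊢
      rw [← kb]
      abel
    · rw [Subgroup.coe_zpow, map_zpow, ofMul_zpow, e, map_zsmul, map_zsmul]
      congr 1
      rw [barD2_single]
      simp only [map_add, map_sub, Finsupp.liftAddHom_apply_single, zmultiplesHom_apply, one_smul,
        map_mul, map_inv, ofMul_mul, ofMul_inv]
      abel

/-- The universal central-type quotient `F/[N,F]`. -/
abbrev HopfE := FreeGroup α ⧸ ⁅N, (⊤ : Subgroup (FreeGroup α))⁆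

instance hopfCenterComm : CommGroup (Subgroup.center (HopfE N)) :=
  { (Subgroup.center (HopfE N)).toGroup with
    mul_comm := fun a b => Subtype.ext ((Subgroup.mem_center_iff.1 b.2 a)) }

theorem hopf_central {n : FreeGroup α} (hn : n ∈ N) :
    (n : HopfE N) ∈ Subgroup.center (HopfE N) := by
  rw [Subgroup.mem_center_iff]
  intro x
  obtain ⟨f, rfl⟩ := QuotientGroup.mk_surjective x
  symm
  rw [← commutatorElement_eq_one_iff_mul_comm]
  exact (QuotientGroup.eq_one_iff (n * f * n⁻¹ * f⁻¹)).2 (Subgroup.commutator_mem_commutator hn (Subgroup.mem_top f))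

/-- Values of the section cocycle. -/
def hopfK (g h : FreeGroup α ⧸ N) : Subgroup.center (HopfE N) :=
  ⟨_, hopf_central N (hopf_mem N g h)⟩

theorem hopfK_mul (g h : FreeGroup α ⧸ N) : (hopfK N g h : HopfE N) * (hopfS N (g * h) : HopfE N) =
    (hopfS N g : HopfE N) * (hopfS N h : HopfE N) := by
  simp [hopfK]

theorem hopfK_cocycle (g h k : FreeGroup α ⧸ N) :
    hopfK N g h * hopfK N (g * h) k = hopfK N h k * hopfK N g (h * k) := by
  apply Subtype.ext
  rw [Subgroup.coe_mul, Subgroup.coe_mul]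
  apply mul_right_cancel (b := (hopfS N (g * h * k) : HopfE N))
  have hc := Subgroup.mem_center_iff.1 (hopfK N h k).2 (hopfS N g : HopfE N)
  rw [mul_assoc, hopfK_mul, ← mul_assoc, hopfK_mul, mul_assoc _ _ (hopfS N (g * h * k) : HopfE N),
    mul_assoc g h k, hopfK_mul, ← mul_assoc, ← hc, mul_assoc, mul_assoc, hopfK_mul]

/-- The evaluation of the section cocycle on chains. -/
def hopfPhi0 : (((FreeGroup α ⧸ N) × (FreeGroup α ⧸ N)) →₀ ℤ) →+
    Additive (Subgroup.center (HopfE N)) :=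
  Finsupp.liftAddHom (fun p : (FreeGroup α ⧸ N) × (FreeGroup α ⧸ N) => zmultiplesHom _ (Additive.ofMul (hopfK N p.1 p.2)))

theorem hopfPhi0_comp : (hopfPhi0 N).comp (barD3 _) = 0 := by
  apply barHom_eq
  rintro ⟨g, h, k⟩
  have := congrArg Additive.ofMul (hopfK_cocycle N g h k)
  simp only [ofMul_mul] at this
  simp only [AddMonoidHom.comp_apply, barD3_single, map_add, map_sub, hopfPhi0,
    Finsupp.liftAddHom_apply_single, zmultiplesHom_apply, one_smul, AddMonoidHom.zero_apply]
  rw [← sub_eq_zero, ← neg_eq_zero] at this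
  rw [← this]
  abel

/-- The evaluation of the section cocycle on chains modulo boundaries. -/
def hopfPhi : BarB (FreeGroup α ⧸ N) →+ Additive (Subgroup.center (HopfE N)) :=
  QuotientAddGroup.lift _ (hopfPhi0 N) (by
    rintro _ ⟨x, rfl⟩
    exact DFunLike.congr_fun (hopfPhi0_comp N) x)

theorem hopfPhi_C (g h : FreeGroup α ⧸ N) :
    hopfPhi N (barC g h) = Additive.ofMul (hopfK N g h) := by
  change hopfPhi0 N _ = _
  simp [hopfPhi0]

/-- Comparison of extensions. -/
def hopfBig : BarX (FreeGroup α ⧸ N) →* HopfE N :=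
  MonoidHom.mk' (fun x => ((hopfPhi N x.b).toMul : HopfE N) * (hopfS N x.g : HopfE N)) (by
    intro x y
    have hc := Subgroup.mem_center_iff.1 (hopfPhi N y.b).toMul.2 (hopfS N x.g : HopfE N)
    simp only [BarX.mul_b, BarX.mul_g, map_add, toMul_add, hopfPhi_C, toMul_ofMul,
      Subgroup.coe_mul]
    rw [mul_assoc, hopfK_mul, mul_assoc, mul_assoc, ← mul_assoc _ _ (hopfS N y.g : HopfE N),
      ← hc, mul_assoc])

theorem hopfBig_apply (x : BarX (FreeGroup α ⧸ N)) :
    hopfBig N x = ((hopfPhi N x.b).toMul : HopfE N) * (hopfS N x.g : HopfE N) := rfl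

theorem hopf_diff (x : FreeGroup α) :
    hopfBig N (hopfTheta N x) * (x : HopfE N)⁻¹ ∈ Subgroup.center (HopfE N) := by
  rw [hopfBig_apply, mul_assoc]
  refine mul_mem (hopfPhi N _).toMul.2 ?_
  rw [hopfTheta_g]
  have : hopfS N x * x⁻¹ ∈ N := by
    rw [← QuotientGroup.eq_one_iff]
    simp [hopfS_mk]
  exact hopf_central N this

/-- The difference homomorphism. -/
def hopfDelta : FreeGroup α →* Subgroup.center (HopfE N) :=
  MonoidHom.mk' (fun x => ⟨_, hopf_diff N x⟩) (by
    intro x y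
    apply Subtype.ext
    have hc := Subgroup.mem_center_iff.1 (hopf_diff N y) (x : HopfE N)⁻¹
    simp only [Subgroup.coe_mul, map_mul, QuotientGroup.mk_mul, mul_inv_rev]
    rw [mul_assoc (hopfBig N (hopfTheta N x)), mul_assoc (hopfBig N (hopfTheta N x)), hc]
    simp only [mul_assoc])

theorem hopf_big_comm {x : FreeGroup α} (hx : x ∈ commutator (FreeGroup α)) :
    hopfBig N (hopfTheta N x) = x := by
  have h := Abelianization.commutator_subset_ker (hopfDelta N) hx
  rw [MonoidHom.mem_ker] at h
  have := congrArg Subtype.val h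
  exact mul_inv_eq_one.1 this

/-- The map from `N ∩ [F,F]`. -/
def hopfU : ↥(N ⊓ commutator (FreeGroup α)) →* Multiplicative (BarB (FreeGroup α ⧸ N)) :=
  (hopfPsi N).comp (Subgroup.inclusion inf_le_left)

theorem hopfU_ker : (hopfU N).ker =
    (⁅N, (⊤ : Subgroup (FreeGroup α))⁆).subgroupOf (N ⊓ commutator (FreeGroup α)) := by
  ext x
  rw [MonoidHom.mem_ker, Subgroup.mem_subgroupOf]
  change hopfPsi N _ = 1 ↔ _
  rw [hopfPsi_eq_one]
  constructor
  · intro h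
    have := hopf_big_comm N x.2.2
    change hopfTheta N x = 1 at h
    rw [h, map_one] at this
    exact (QuotientGroup.eq_one_iff _).1 this.symm
  · intro h
    exact hopfTheta_comm N h

/-- The map from cycles. -/
def hopfV : ↥(barD2 (FreeGroup α ⧸ N)).ker →+ BarB (FreeGroup α ⧸ N) :=
  (QuotientAddGroup.mk' _).comp (AddSubgroup.subtype _)

theorem hopfV_ker : (hopfV N).ker =
    (barD3 (FreeGroup α ⧸ N)).range.addSubgroupOf (barD2 (FreeGroup α ⧸ N)).ker := by
  ext x
  rw [AddMonoidHom.mem_ker, AddSubgroup.mem_addSubgroupOf]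
  exact QuotientAddGroup.eq_zero_iff _

theorem hopf_range : (hopfV N).range = (MonoidHom.toAdditiveLeft (hopfU N)).range := by
  ext y
  constructor
  · rintro ⟨⟨z, hz⟩, rfl⟩
    obtain ⟨n, hn, hn'⟩ := hopf_chain N z
    rw [AddMonoidHom.mem_ker] at hz
    rw [hz, map_zero] at hn hn'
    refine ⟨Additive.ofMul ⟨n, n.2, ?_⟩, ?_⟩
    · rw [← Abelianization.ker_of]
      exact hn'
    · rw [add_zero] at hn
      exact hn
  · rintro ⟨x, rfl⟩
    obtain ⟨n, hn, hc⟩ := x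
    obtain ⟨z, hz⟩ := QuotientAddGroup.mk_surjective ((hopfTheta N n).b + barC 1 1)
    refine ⟨⟨z, ?_⟩, hz⟩
    have h := Abelianization.commutator_subset_ker ((BarX.toC1 _).comp (hopfTheta N)) hc
    have h2 : barDbar _ (hopfTheta N n).b + Finsupp.single (hopfTheta N n).g 1 = 0 := h
    rw [hopfTheta_g_mem N hn] at h2
    rw [AddMonoidHom.mem_ker]
    change barDbar _ (QuotientAddGroup.mk z) = 0
    rw [hz, map_add, barDbar_C, ← h2, mul_one]
    abel

end hopf

/-- Hopf's formula: if `F` is a free group and `N ⊴ F`, then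
`H₂(F/N, ℤ) ≅ (N ∩ [F,F]) / [N,F]`, identifying the Schur multiplier of the
quotient with a relative commutator quotient. -/
theorem hopf_formula {α : Type*} (N : Subgroup (FreeGroup α)) [N.Normal] :
    Nonempty (H2 (FreeGroup α ⧸ N) ≃+
      Additive (↥(N ⊓ commutator (FreeGroup α)) ⧸
        ((⁅N, (⊤ : Subgroup (FreeGroup α))⁆).subgroupOf (N ⊓ commutator (FreeGroup α))))) := by
  have e1 := (QuotientAddGroup.quotientAddEquivOfEq (hopfV_ker N).symm).trans
    (QuotientAddGroup.quotientKerEquivRange (hopfV N))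
  have e2 := (QuotientGroup.quotientMulEquivOfEq (hopfU_ker N).symm).trans
    (QuotientGroup.quotientKerEquivRange (hopfU N))
  have e3 : (hopfV N).range ≃+ Additive (hopfU N).range :=
    (AddEquiv.addSubgroupCongr (hopf_range N)).trans
      { toFun := fun x => Additive.ofMul ⟨Multiplicative.ofAdd x.1, x.2⟩
        invFun := fun x => ⟨(x.toMul.1).toAdd, x.toMul.2⟩
        left_inv := fun _ => rfl
        right_inv := fun _ => rfl
        map_add' := fun _ _ => rfl }
  exact ⟨(e1.trans e3).trans (MulEquiv.toAdditive e2).symm⟩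

end
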